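/- There exist β_h > 0 and δ > 0 such that for every β with 0 < β ≤ β_h and every translation invariant interaction Ψ on Ω = {1,-1}^{Z^d} with |||Ψ||| < δ, the interaction Φ = Φ^β + Ψ has a unique Gibbs state. -/

import Mathlib

open scoped BigOperators
open Real MeasureTheory Filter Topology

namespace Ising

/-- The lattice `ℤ^d`. -/
abbrev V (d : ℕ) := Fin d → ℤ
/-- Spin configurations on `ℤ^d`; `true` encodes spin `+1`, `false` encodes spin `-1`. -/
abbrev Config (d : ℕ) := V d → Bool
/-- The ambient euclidean space `ℝ^d`. -/
abbrev Point (d : ℕ) := Fin d → ℝ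

variable {d : ℕ}

noncomputable section

/-- The spin value (`±1`) of a boolean. -/
def spin (b : Bool) : ℝ := if b then 1 else -1

/-- An interaction assigns to each finite `Λ ⊆ ℤ^d` a function of configurations
(only the restriction to `Λ` is relevant; see `IsLocal`). -/
abbrev Interaction (d : ℕ) := Finset (V d) → Config d → ℝ

/-- `Φ_Λ` depends only on the restriction of the configuration to `Λ`. -/
def IsLocal (Φ : Interaction d) : Prop :=
  ∀ (Λ : Finset (V d)) (ω ω' : Config d), (∀ x ∈ Λ, ω x = ω' x) → Φ Λ ω = Φ Λ ω'

/-- Translation of a configuration: `(τ^a ω)(x) = ω(x+a)`. -/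
def translate (a : V d) (ω : Config d) : Config d := fun x => ω (x + a)

/-- Translation invariance of an interaction: `Φ_Λ(ω) = Φ_{Λ-a}(τ^a ω)`. -/
def TransInv (Φ : Interaction d) : Prop :=
  ∀ (a : V d) (Λ : Finset (V d)) (ω : Config d),
    Φ (Λ.image (fun x => x - a)) (translate a ω) = Φ Λ ω

/-- Spin-flip symmetry: `Ψ_Λ(ω) = Ψ_Λ(-ω)`. -/
def SpinFlipSymm (Ψ : Interaction d) : Prop :=
  ∀ (Λ : Finset (V d)) (ω : Config d), Ψ Λ (fun x => !(ω x)) = Ψ Λ ω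

/-- `sup_{ω ∈ Ω_Λ} |Φ_Λ(ω)|`. -/
def supNorm (Φ : Interaction d) (Λ : Finset (V d)) : ℝ := ⨆ ω : Config d, |Φ Λ ω|

/-- The summand of the norm `‖Φ‖`. -/
def normTerm (Φ : Interaction d) (Λ : Finset (V d)) : ℝ :=
  if (0 : V d) ∈ Λ then supNorm Φ Λ else 0

/-- `‖Φ‖ = Σ_{0 ∈ Λ ⋐ ℤ^d} sup_{ω} |Φ_Λ(ω)|`. -/
def anorm (Φ : Interaction d) : ℝ := ∑' Λ : Finset (V d), normTerm Φ Λ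

/-- Absolute summability of an interaction. -/
def AbsSummable (Φ : Interaction d) : Prop := Summable (normTerm Φ)

/-- `‖x-y‖_∞`. -/
def distInf (x y : V d) : ℕ := Finset.univ.sup fun i => (x i - y i).natAbs

/-- `‖x-y‖_1`. -/
def dist1 (x y : V d) : ℕ := ∑ i, (x i - y i).natAbs

/-- `diam(Λ) = sup {‖x-y‖_∞ : x, y ∈ Λ}`. -/
def diam (Λ : Finset (V d)) : ℕ := Λ.sup fun x => Λ.sup fun y => distInf x y

/-- The summand of the `d`-th order decaying norm `|||Ψ|||`. -/
def dTerm (Ψ : Interaction d) (Λ : Finset (V d)) : ℝ :=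
  if (0 : V d) ∈ Λ then ((diam Λ + 1 : ℕ) : ℝ) ^ d * supNorm Ψ Λ else 0

/-- `|||Ψ||| = Σ_{0 ∈ Λ ⋐ ℤ^d} (diam(Λ)+1)^d sup_{ω} |Ψ_Λ(ω)|`. -/
def dnorm (Ψ : Interaction d) : ℝ := ∑' Λ : Finset (V d), dTerm Ψ Λ

/-- Summability of the `d`-th order decaying norm. -/
def DSummable (Ψ : Interaction d) : Prop := Summable (dTerm Ψ)

/-- The summand of the norm `|||Ψ|||'`. -/
def dTerm' (Ψ : Interaction d) (Λ : Finset (V d)) : ℝ :=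
  if (0 : V d) ∈ Λ then (Λ.card : ℝ)⁻¹ * ((diam Λ + 1 : ℕ) : ℝ) ^ d * supNorm Ψ Λ else 0

/-- `|||Ψ|||' = Σ_{0 ∈ Λ ⋐ ℤ^d} |Λ|⁻¹ (diam(Λ)+1)^d sup_{ω} |Ψ_Λ(ω)|`. -/
def dnorm' (Ψ : Interaction d) : ℝ := ∑' Λ : Finset (V d), dTerm' Ψ Λ

/-- Summability of the norm `|||·|||'`. -/
def DSummable' (Ψ : Interaction d) : Prop := Summable (dTerm' Ψ)

/-- The Hamiltonian `H_{Φ,Λ}(ω) = Σ_{Δ ⋐ ℤ^d, Δ ∩ Λ ≠ ∅} Φ_Δ(ω|_Δ)`. -/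
def ham (Φ : Interaction d) (Λ : Finset (V d)) (ω : Config d) : ℝ :=
  ∑' Δ : Finset (V d), if (Δ ∩ Λ).Nonempty then Φ Δ ω else 0

/-- The configuration `ω_Λ ∨ η` agreeing with `f` on `Λ` and with `η` off `Λ`. -/
def fill (Λ : Finset (V d)) (f : ↥Λ → Bool) (η : Config d) : Config d :=
  fun x => if h : x ∈ Λ then f ⟨x, h⟩ else η x

/-- The partition function `Z^η_{Φ,Λ}`. -/
def gibbsZ (Φ : Interaction d) (Λ : Finset (V d)) (η : Config d) : ℝ :=
  ∑ f : ↥Λ → Bool, Real.exp (-(ham Φ Λ (fill Λ f η)))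

/-- The finite Gibbs state `μ^η_{Φ,Λ}({ω_Λ})`. -/
def finGibbs (Φ : Interaction d) (Λ : Finset (V d)) (η : Config d) (f : ↥Λ → Bool) : ℝ :=
  Real.exp (-(ham Φ Λ (fill Λ f η))) / gibbsZ Φ Λ η

/-- The cylinder set `{ξ : ξ|_Λ = f}`. -/
def cyl (Λ : Finset (V d)) (f : ↥Λ → Bool) : Set (Config d) :=
  {ξ | ∀ (x : V d) (h : x ∈ Λ), ξ x = f ⟨x, h⟩}

/-- `σ` is a Gibbs state for `Φ` (DLR condition): for each finite `Λ` there is a Borel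
probability measure on boundary conditions with respect to which `σ` of each cylinder
is the average of the finite Gibbs states. -/
def IsGibbs (Φ : Interaction d) (σ : Measure (Config d)) : Prop :=
  IsProbabilityMeasure σ ∧
  ∀ Λ : Finset (V d), ∃ ν : Measure (Config d), IsProbabilityMeasure ν ∧
    ∀ f : ↥Λ → Bool, (σ (cyl Λ f)).toReal = ∫ η, finGibbs Φ Λ η f ∂ν

/-- Translation invariance of a measure: `τ^a_* σ = σ`. -/
def MeasTransInv (σ : Measure (Config d)) : Prop :=
  ∀ a : V d, σ.map (translate a) = σ

/-- The Ising interaction at inverse temperature `β`: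
`Φ^β_Λ(ω) = -β ω(x) ω(y)` if `Λ = {x,y}` with `‖x-y‖₁ = 1`, and `0` otherwise. -/
def ising (β : ℝ) : Interaction d := fun Λ ω =>
  if Λ.card = 2 ∧ ∀ x ∈ Λ, ∀ y ∈ Λ, x ≠ y → dist1 x y = 1
  then -β * ∏ x ∈ Λ, spin (ω x) else 0

/-- The sum of two interactions. -/
def Iadd (Φ Ψ : Interaction d) : Interaction d := fun Λ ω => Φ Λ ω + Ψ Λ ω

/-- `S` is connected for the adjacency given by `ρ`-distance `1`. -/
def ConnectedBy (ρ : V d → V d → ℕ) (S : Set (V d)) : Prop :=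
  ∀ x ∈ S, ∀ y ∈ S, ∃ (n : ℕ) (p : ℕ → V d), p 0 = x ∧ p n = y ∧
    (∀ i ≤ n, p i ∈ S) ∧ ∀ i < n, ρ (p i) (p (i+1)) = 1

/-- `‖·‖₁`-connectedness. -/
def Conn1 (S : Set (V d)) : Prop := ConnectedBy dist1 S

/-- `‖·‖_∞`-connectedness. -/
def ConnInf (S : Set (V d)) : Prop := ConnectedBy distInf S

/-- A finite set `Λ` is c-connected if both `Λ` and its complement are `‖·‖_∞`-connected. -/
def CConn (Λ : Finset (V d)) : Prop :=
  ConnInf (↑Λ : Set (V d)) ∧ ConnInf ((↑Λ : Set (V d))ᶜ)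

/-- `Ψ` vanishes on sets that are not `‖·‖₁`-connected. -/
def ZeroOnNonConn (Ψ : Interaction d) : Prop :=
  ∀ Λ : Finset (V d), ¬ Conn1 (↑Λ : Set (V d)) → ∀ ω, Ψ Λ ω = 0

/-- The closed unit cube `I_x` centered at `x ∈ ℤ^d`. -/
def cube (x : V d) : Set (Point d) := {y | ∀ i, |y i - (x i : ℝ)| ≤ 1/2}

/-- `M(S) = ⋃_{x ∈ S} I_x`. -/
def cubes (S : Set (V d)) : Set (Point d) := ⋃ x ∈ S, cube x

/-- A contour is the boundary `∂M(S)` of `M(S)` for a finite c-connected `S`. -/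
def IsContour (γ : Set (Point d)) : Prop :=
  ∃ S : Finset (V d), CConn S ∧ γ = frontier (cubes ↑S)

/-- The set of sites with spin `-1`. -/
def minusSet (ω : Config d) : Set (V d) := {x | ω x = false}

/-- `Γ(ω)`: the connected components of `∂M({x : ω(x) = -1})`. -/
def Gamma (ω : Config d) : Set (Set (Point d)) :=
  {γ | ∃ y ∈ frontier (cubes (minusSet ω)),
    γ = connectedComponentIn (frontier (cubes (minusSet ω))) y}

/-- The `(d-1)`-dimensional face of the unit cubes lying between `x` and `x + e_i`. -/
def face (x : V d) (i : Fin d) : Set (Point d) :=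
  {y | y i = (x i : ℝ) + 1/2 ∧ ∀ j, j ≠ i → |y j - (x j : ℝ)| ≤ 1/2}

/-- A plaquette is a `(d-1)`-dimensional face of one of the cubes `I_x`. -/
def IsPlaquette (P : Set (Point d)) : Prop := ∃ x i, P = face x i

/-- `|γ|`: the number of plaquettes contained in `γ`. -/
def csize (γ : Set (Point d)) : ℕ :=
  Nat.card {P : Set (Point d) // IsPlaquette P ∧ P ⊆ γ}

/-- The constant `+1` configuration. -/
def plusC : Config d := fun _ => true

/-- The constant `-1` configuration. -/
def minusC : Config d := fun _ => false

open scoped Classical in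
/-- The finite-volume Gibbs probability (with boundary condition `η`) of an event
`A`: `μ^η_{Φ,Λ}({ω : ω ∨ η ∈ A})`. -/
def bcProb (Φ : Interaction d) (Λ : Finset (V d)) (η : Config d) (A : Set (Config d)) : ℝ :=
  (∑ f : ↥Λ → Bool, if fill Λ f η ∈ A then Real.exp (-(ham Φ Λ (fill Λ f η))) else 0) /
    gibbsZ Φ Λ η

/-- `ω ∈ Ω_Λ^+`, i.e. `ω` is `+1` off `Λ`. -/
def plusOutside (Λ : Finset (V d)) (ω : Config d) : Prop := ∀ x, x ∉ Λ → ω x = true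

/-- The configuration obtained by flipping all spins in `S`. -/
def flipOn (S : Finset (V d)) (ω : Config d) : Config d :=
  fun x => if x ∈ S then !(ω x) else ω x

/-- `|𝓔_Λ|`: the number of nearest-neighbour edges meeting `Λ`. -/
def edgeCount (Λ : Finset (V d)) : ℕ :=
  Nat.card {e : Finset (V d) // (∃ x y, e = {x, y} ∧ dist1 x y = 1) ∧ (e ∩ Λ).Nonempty}

/-- `R` is a (nonempty) rectangle in `ℤ^d`. -/
def IsRect (R : Finset (V d)) : Prop := ∃ a b : V d, a ≤ b ∧ R = Finset.Icc a b

/-- `R(Λ)`: the minimal rectangle containing `Λ`. -/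
def minRect (Λ : Finset (V d)) : Finset (V d) :=
  if h : Λ.Nonempty then
    Finset.Icc (fun i => Λ.inf' h fun x => x i) (fun i => Λ.sup' h fun x => x i)
  else ∅

open scoped Classical in
/-- The rectangle regrouping `Ψ̃` of `Ψ`: `Ψ̃_R(ω) = Σ_{Λ : R(Λ) = R} Ψ_Λ(ω|_Λ)` for
rectangles `R`, and `Ψ̃_Λ = 0` for non-rectangles. -/
def regroup (Ψ : Interaction d) : Interaction d := fun R ω =>
  if IsRect R then ∑ Λ ∈ R.powerset, (if minRect Λ = R then Ψ Λ ω else 0) else 0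


/-! ### Auxiliary development: Dobrushin uniqueness -/

/-- `Φ` is local and dominated by `N`, with uniformly summable `|Δ| N(Δ)`. -/
structure Dom (Φ : Interaction d) (N : Finset (V d) → ℝ) (S : ℝ) : Prop where
  loc : IsLocal Φ
  bd : ∀ Δ ω, |Φ Δ ω| ≤ N Δ
  sm : ∀ x : V d, Summable (fun Δ : Finset (V d) => if x ∈ Δ then (Δ.card : ℝ) * N Δ else 0)
  le : ∀ x : V d, ∑' Δ : Finset (V d), (if x ∈ Δ then (Δ.card : ℝ) * N Δ else 0) ≤ S

lemma Dom.nn {Φ : Interaction d} {N : Finset (V d) → ℝ} {S : ℝ} (h : Dom Φ N S)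
    (Δ : Finset (V d)) : 0 ≤ N Δ := (abs_nonneg _).trans (h.bd Δ plusC)

lemma Dom.term_le {Φ : Interaction d} {N : Finset (V d) → ℝ} {S : ℝ} (h : Dom Φ N S)
    {Δ : Finset (V d)} {x : V d} (hx : x ∈ Δ) : N Δ ≤ (Δ.card : ℝ) * N Δ := by
  have h1 : (1:ℝ) ≤ Δ.card := by exact_mod_cast Finset.card_pos.mpr ⟨x, hx⟩
  nlinarith [h.nn Δ]

lemma Dom.meet {Φ : Interaction d} {N : Finset (V d) → ℝ} {S : ℝ} (h : Dom Φ N S)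
    (Λ : Finset (V d)) :
    Summable (fun Δ : Finset (V d) => if (Δ ∩ Λ).Nonempty then N Δ else 0) := by
  have hs : Summable (fun Δ : Finset (V d) =>
      ∑ x ∈ Λ, if x ∈ Δ then (Δ.card : ℝ) * N Δ else 0) :=
    summable_sum (fun x _ => h.sm x)
  have hnn : ∀ (Δ : Finset (V d)) (x : V d),
      0 ≤ (if x ∈ Δ then (Δ.card : ℝ) * N Δ else 0) := by
    intro Δ x
    split_ifs
    · exact mul_nonneg (Nat.cast_nonneg _) (h.nn Δ)
    · exact le_rfl
  refine Summable.of_nonneg_of_le (fun Δ => ?_) (fun Δ => ?_) hs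
  · split_ifs
    · exact h.nn Δ
    · exact le_rfl
  · split_ifs with hne
    · obtain ⟨x, hx⟩ := hne
      rw [Finset.mem_inter] at hx
      calc N Δ ≤ (if x ∈ Δ then (Δ.card : ℝ) * N Δ else 0) := by
            rw [if_pos hx.1]; exact h.term_le hx.1
        _ ≤ _ := Finset.single_le_sum
            (f := fun x => if x ∈ Δ then (Δ.card : ℝ) * N Δ else 0)
            (fun y _ => hnn Δ y) hx.2
    · exact Finset.sum_nonneg (fun y _ => hnn Δ y)

lemma Dom.meet_abs {Φ : Interaction d} {N : Finset (V d) → ℝ} {S : ℝ} (h : Dom Φ N S)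
    (Λ : Finset (V d)) (Δ : Finset (V d)) (ω : Config d) :
    ‖(if (Δ ∩ Λ).Nonempty then Φ Δ ω else 0)‖ ≤ if (Δ ∩ Λ).Nonempty then N Δ else 0 := by
  split_ifs
  · exact h.bd Δ ω
  · simp

lemma Dom.meet_sm {Φ : Interaction d} {N : Finset (V d) → ℝ} {S : ℝ} (h : Dom Φ N S)
    (Λ : Finset (V d)) (ω : Config d) :
    Summable (fun Δ : Finset (V d) => if (Δ ∩ Λ).Nonempty then Φ Δ ω else 0) :=
  Summable.of_norm_bounded (h.meet Λ) (fun Δ => h.meet_abs Λ Δ ω)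

lemma local_continuous {g : Config d → ℝ} {Λ : Finset (V d)}
    (hg : ∀ ω ω' : Config d, (∀ x ∈ Λ, ω x = ω' x) → g ω = g ω') : Continuous g := by
  rw [continuous_iff_continuousAt]
  intro ω
  refine tendsto_const_nhds.congr' (f₁ := fun _ => g ω) ?_
  have : ∀ᶠ ω' in 𝓝 ω, ∀ x ∈ Λ, ω x = ω' x := by
    rw [Filter.eventually_all_finset]
    intro x _
    have hc : Continuous (fun ω' : Config d => ω' x) := continuous_apply x
    have ho : IsOpen ((fun ω' : Config d => ω' x) ⁻¹' {ω x}) := (isOpen_discrete _).preimage hc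
    filter_upwards [ho.mem_nhds rfl] with ω' h'
    exact h'.symm
  filter_upwards [this] with ω' h
  exact hg _ _ h

lemma Dom.ham_cont {Φ : Interaction d} {N : Finset (V d) → ℝ} {S : ℝ} (h : Dom Φ N S)
    (Λ : Finset (V d)) : Continuous (ham Φ Λ) := by
  unfold ham
  refine continuous_tsum (fun Δ => ?_) (h.meet Λ) (fun Δ ω => h.meet_abs Λ Δ ω)
  split_ifs
  · exact local_continuous (h.loc Δ)
  · exact continuous_const

lemma fill_cont (Λ : Finset (V d)) (f : ↥Λ → Bool) : Continuous (fill Λ f) := by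
  refine continuous_pi (fun x => ?_)
  unfold fill
  by_cases h : x ∈ Λ
  · simp only [h, dif_pos]; exact continuous_const
  · simp only [h, dif_neg, not_false_eq_true]; exact continuous_apply x

lemma gibbsZ_pos (Φ : Interaction d) (Λ : Finset (V d)) (η : Config d) : 0 < gibbsZ Φ Λ η :=
  Finset.sum_pos (fun _ _ => Real.exp_pos _) Finset.univ_nonempty

lemma finGibbs_nonneg (Φ : Interaction d) (Λ : Finset (V d)) (η : Config d) (f : ↥Λ → Bool) :
    0 ≤ finGibbs Φ Λ η f := div_nonneg (Real.exp_pos _).le (gibbsZ_pos _ _ _).le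

lemma finGibbs_sum (Φ : Interaction d) (Λ : Finset (V d)) (η : Config d) :
    ∑ f : ↥Λ → Bool, finGibbs Φ Λ η f = 1 := by
  unfold finGibbs
  rw [← Finset.sum_div]
  exact div_self (gibbsZ_pos Φ Λ η).ne'

lemma Dom.finGibbs_cont {Φ : Interaction d} {N : Finset (V d) → ℝ} {S : ℝ} (h : Dom Φ N S)
    (Λ : Finset (V d)) (f : ↥Λ → Bool) : Continuous (fun η => finGibbs Φ Λ η f) := by
  have h1 : ∀ f : ↥Λ → Bool, Continuous (fun η => Real.exp (-(ham Φ Λ (fill Λ f η)))) :=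
    fun f => Real.continuous_exp.comp ((h.ham_cont Λ).comp (fill_cont Λ f)).neg
  unfold finGibbs
  refine (h1 f).div ?_ (fun η => (gibbsZ_pos Φ Λ η).ne')
  unfold gibbsZ
  exact continuous_finsetSum _ (fun f _ => h1 f)

/-- The Gibbs kernel acting on functions. -/
def gam (Φ : Interaction d) (Λ : Finset (V d)) (g : Config d → ℝ) (η : Config d) : ℝ :=
  ∑ f : ↥Λ → Bool, finGibbs Φ Λ η f * g (fill Λ f η)

lemma Dom.gam_cont {Φ : Interaction d} {N : Finset (V d) → ℝ} {S : ℝ} (h : Dom Φ N S)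
    (Λ : Finset (V d)) {g : Config d → ℝ} (hg : Continuous g) : Continuous (gam Φ Λ g) :=
  continuous_finsetSum _ (fun f _ => (h.finGibbs_cont Λ f).mul (hg.comp (fill_cont Λ f)))

lemma Dom.ham_diff {Φ : Interaction d} {N : Finset (V d) → ℝ} {S : ℝ} (h : Dom Φ N S)
    {Λ Λ' : Finset (V d)} (hΛ : Λ ⊆ Λ') (ω ω' : Config d) (hω : ∀ x, x ∉ Λ → ω x = ω' x) :
    ham Φ Λ' ω - ham Φ Λ ω = ham Φ Λ' ω' - ham Φ Λ ω' := by
  unfold ham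
  rw [← (h.meet_sm Λ' ω).tsum_sub (h.meet_sm Λ ω), ← (h.meet_sm Λ' ω').tsum_sub (h.meet_sm Λ ω')]
  refine tsum_congr (fun Δ => ?_)
  by_cases h1 : (Δ ∩ Λ).Nonempty
  · have h2 : (Δ ∩ Λ').Nonempty := h1.mono (Finset.inter_subset_inter_left hΛ)
    simp [h1, h2]
  · have : Φ Δ ω = Φ Δ ω' := by
      refine h.loc Δ ω ω' (fun x hx => hω x (fun hx' => h1 ⟨x, Finset.mem_inter.2 ⟨hx, hx'⟩⟩))
    simp [h1, this]

lemma fill_fill (Λ : Finset (V d)) (f f' : ↥Λ → Bool) (η : Config d) :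
    fill Λ f (fill Λ f' η) = fill Λ f η := by
  funext x
  unfold fill
  by_cases h : x ∈ Λ <;> simp [h]

lemma fill_off (Λ : Finset (V d)) (f : ↥Λ → Bool) (η : Config d) {x : V d} (hx : x ∉ Λ) :
    fill Λ f η x = η x := by simp [fill, hx]

lemma fill_on (Λ : Finset (V d)) (f : ↥Λ → Bool) (η : Config d) {x : V d} (hx : x ∈ Λ) :
    fill Λ f η x = f ⟨x, hx⟩ := by simp [fill, hx]

lemma gibbsZ_fill (Φ : Interaction d) (Λ : Finset (V d)) (f : ↥Λ → Bool) (η : Config d) :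
    gibbsZ Φ Λ (fill Λ f η) = gibbsZ Φ Λ η := by
  unfold gibbsZ
  simp only [fill_fill]

/-- Restriction of a configuration. -/
def rst (Λ : Finset (V d)) (ω : Config d) : ↥Λ → Bool := fun x => ω x

lemma fill_rst (Λ : Finset (V d)) (ω : Config d) : fill Λ (rst Λ ω) ω = ω := by
  funext x
  by_cases h : x ∈ Λ
  · rw [fill_on _ _ _ h]; rfl
  · rw [fill_off _ _ _ h]

lemma rst_fill (Λ : Finset (V d)) (f : ↥Λ → Bool) (ω : Config d) : rst Λ (fill Λ f ω) = f := by
  funext x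
  exact fill_on _ _ _ x.2

lemma fill_rst_big {Λ Λ' : Finset (V d)} (hΛ : Λ ⊆ Λ') (f : ↥Λ → Bool) (f' : ↥Λ' → Bool)
    (η : Config d) :
    fill Λ' (rst Λ' (fill Λ f (fill Λ' f' η))) η = fill Λ f (fill Λ' f' η) := by
  funext x
  by_cases h : x ∈ Λ'
  · rw [fill_on _ _ _ h]; rfl
  · rw [fill_off _ _ _ h, fill_off _ _ _ (fun h' => h (hΛ h')), fill_off _ _ _ h]

/-- Consistency of the Gibbs kernels. -/
lemma Dom.consistent {Φ : Interaction d} {N : Finset (V d) → ℝ} {S : ℝ} (h : Dom Φ N S)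
    {Λ Λ' : Finset (V d)} (hΛ : Λ ⊆ Λ') (g : Config d → ℝ) (η : Config d) :
    gam Φ Λ' (gam Φ Λ g) η = gam Φ Λ' g η := by
  have key : ∑ p : (↥Λ' → Bool) × (↥Λ → Bool),
        finGibbs Φ Λ' η p.1 * (finGibbs Φ Λ (fill Λ' p.1 η) p.2 * g (fill Λ p.2 (fill Λ' p.1 η)))
      = ∑ p : (↥Λ' → Bool) × (↥Λ → Bool),
        finGibbs Φ Λ' η p.1 * (finGibbs Φ Λ (fill Λ' p.1 η) p.2 * g (fill Λ' p.1 η)) := by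
    let T : (↥Λ' → Bool) × (↥Λ → Bool) → (↥Λ' → Bool) × (↥Λ → Bool) := fun p =>
      (rst Λ' (fill Λ p.2 (fill Λ' p.1 η)), rst Λ (fill Λ' p.1 η))
    have hT : Function.Involutive T := by
      rintro ⟨a, b⟩
      simp only [T, fill_rst_big hΛ, fill_fill, fill_rst, rst_fill]
    refine Fintype.sum_equiv hT.toPerm _ _ (fun p => ?_)
    obtain ⟨a, b⟩ := p
    simp only [Function.Involutive.coe_toPerm, T, fill_rst_big hΛ, finGibbs, fill_fill, fill_rst,
      gibbsZ_fill]
    have hd := h.ham_diff hΛ (fill Λ' a η) (fill Λ b (fill Λ' a η))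
      (fun x hx => (fill_off _ _ _ hx).symm)
    have he : Real.exp (-(ham Φ Λ' (fill Λ' a η))) * Real.exp (-(ham Φ Λ (fill Λ b (fill Λ' a η))))
        = Real.exp (-(ham Φ Λ' (fill Λ b (fill Λ' a η)))) * Real.exp (-(ham Φ Λ (fill Λ' a η))) := by
      rw [← Real.exp_add, ← Real.exp_add]
      congr 1
      linarith
    calc _ = (Real.exp (-(ham Φ Λ' (fill Λ' a η))) *
          Real.exp (-(ham Φ Λ (fill Λ b (fill Λ' a η))))) /
          (gibbsZ Φ Λ' η * gibbsZ Φ Λ (fill Λ' a η)) * g (fill Λ b (fill Λ' a η)) := by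
          field_simp
      _ = _ := by rw [he]; field_simp
  rw [Fintype.sum_prod_type, Fintype.sum_prod_type] at key
  simp only [← Finset.mul_sum, ← Finset.sum_mul, finGibbs_sum, one_mul] at key
  exact key

/-- `b` bounds the single-site oscillations of `f`. -/
def OscB (f : Config d → ℝ) (b : V d → ℝ) : Prop :=
  ∀ (y : V d) (ω ω' : Config d), (∀ x, x ≠ y → ω x = ω' x) → |f ω - f ω'| ≤ b y

lemma OscB.nn {f : Config d → ℝ} {b : V d → ℝ} (h : OscB f b) (y : V d) : 0 ≤ b y :=
  (abs_nonneg _).trans (h y plusC plusC (fun _ _ => rfl))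

/-- Interpolation between two configurations. -/
def mix (F : Finset (V d)) (ω ω' : Config d) : Config d := fun x => if x ∈ F then ω x else ω' x

lemma mix_tendsto (ω ω' : Config d) : Tendsto (fun F => mix F ω ω') atTop (𝓝 ω) := by
  rw [tendsto_pi_nhds]
  intro x
  refine tendsto_const_nhds.congr' ?_
  filter_upwards [eventually_ge_atTop ({x} : Finset (V d))] with F hF
  have : x ∈ F := hF (Finset.mem_singleton_self x)
  simp [mix, this]

lemma OscB.mix_le {f : Config d → ℝ} {b : V d → ℝ} (h : OscB f b) (Λ F : Finset (V d))
    (ω ω' : Config d) (hω : ∀ x ∈ Λ, ω x = ω' x) :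
    |f (mix F ω ω') - f ω'| ≤ ∑ y ∈ F \ Λ, b y := by
  induction F using Finset.induction_on with
  | empty =>
    have : mix ∅ ω ω' = ω' := by funext x; simp [mix]
    simp [this]
  | insert a F ha ih =>
    by_cases haΛ : a ∈ Λ
    · have h1 : mix (insert a F) ω ω' = mix F ω ω' := by
        funext x
        by_cases hx : x = a
        · subst hx; simp [mix, ha, hω x haΛ]
        · simp [mix, hx]
      rw [h1, Finset.insert_sdiff_of_mem _ haΛ]
      exact ih
    · rw [Finset.insert_sdiff_of_notMem _ haΛ, Finset.sum_insert (by simp [ha])]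
      have h2 := h a (mix (insert a F) ω ω') (mix F ω ω') (fun x hx => by simp [mix, hx])
      calc |f (mix (insert a F) ω ω') - f ω'|
          ≤ |f (mix (insert a F) ω ω') - f (mix F ω ω')| + |f (mix F ω ω') - f ω'| :=
            abs_sub_le _ _ _
        _ ≤ _ := add_le_add h2 ih

lemma OscB.osc_le {f : Config d → ℝ} {b : V d → ℝ} (h : OscB f b) (hf : Continuous f)
    (hb : Summable b) (Λ : Finset (V d)) (ω ω' : Config d) (hω : ∀ x ∈ Λ, ω x = ω' x) :
    |f ω - f ω'| ≤ ∑' y, b y - ∑ y ∈ Λ, b y := by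
  have h1 : Tendsto (fun F => |f (mix F ω ω') - f ω'|) atTop (𝓝 |f ω - f ω'|) :=
    (((hf.tendsto ω).comp (mix_tendsto ω ω')).sub_const _).abs
  refine le_of_tendsto' h1 (fun F => (h.mix_le Λ F ω ω' hω).trans ?_)
  have h2 := hb.sum_le_tsum ((F \ Λ) ∪ Λ) (fun y _ => h.nn y)
  rw [Finset.sum_union Finset.sdiff_disjoint] at h2
  linarith

/-- Dobrushin-type interaction coefficients. -/
def cc (N : Finset (V d) → ℝ) (x y : V d) : ℝ :=
  ∑' Δ : Finset (V d), if x ∈ Δ ∧ y ∈ Δ then N Δ else 0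

lemma Dom.cc_sm {Φ : Interaction d} {N : Finset (V d) → ℝ} {S : ℝ} (h : Dom Φ N S)
    (x y : V d) : Summable (fun Δ : Finset (V d) => if x ∈ Δ ∧ y ∈ Δ then N Δ else 0) := by
  refine Summable.of_nonneg_of_le (fun Δ => ?_) (fun Δ => ?_) (h.sm x)
  · split_ifs
    · exact h.nn Δ
    · exact le_rfl
  · by_cases hx : x ∈ Δ
    · by_cases hy : y ∈ Δ
      · simpa [hx, hy] using h.term_le hx
      · simpa [hx, hy] using mul_nonneg (Nat.cast_nonneg _) (h.nn Δ)
    · simp [hx]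

lemma Dom.cc_nn {Φ : Interaction d} {N : Finset (V d) → ℝ} {S : ℝ} (h : Dom Φ N S)
    (x y : V d) : 0 ≤ cc N x y := by
  refine tsum_nonneg (fun Δ => ?_)
  split_ifs
  · exact h.nn Δ
  · exact le_rfl

lemma Dom.cc_fin {Φ : Interaction d} {N : Finset (V d) → ℝ} {S : ℝ} (h : Dom Φ N S)
    (x : V d) (F : Finset (V d)) : ∑ y ∈ F, cc N x y ≤ S := by
  refine le_trans ?_ (h.le x)
  unfold cc
  rw [← Summable.tsum_finsetSum (fun y _ => h.cc_sm x y)]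
  refine Summable.tsum_le_tsum (fun Δ => ?_) (summable_sum (fun y _ => h.cc_sm x y)) (h.sm x)
  by_cases hx : x ∈ Δ
  · simp only [hx, true_and, if_true]
    rw [← Finset.sum_filter, Finset.sum_const, nsmul_eq_mul]
    refine mul_le_mul_of_nonneg_right ?_ (h.nn Δ)
    exact_mod_cast Finset.card_le_card (fun y hy => (Finset.mem_filter.1 hy).2)
  · simp [hx]

lemma Dom.cc_summable {Φ : Interaction d} {N : Finset (V d) → ℝ} {S : ℝ} (h : Dom Φ N S)
    (x : V d) : Summable (cc N x) :=
  summable_of_sum_le (fun y => h.cc_nn x y) (fun F => h.cc_fin x F)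

lemma Dom.cc_tsum {Φ : Interaction d} {N : Finset (V d) → ℝ} {S : ℝ} (h : Dom Φ N S)
    (x : V d) : ∑' y, cc N x y ≤ S :=
  Real.tsum_le_of_sum_le (fun y => h.cc_nn x y) (fun F => h.cc_fin x F)

lemma Dom.cc_le {Φ : Interaction d} {N : Finset (V d) → ℝ} {S : ℝ} (h : Dom Φ N S)
    (x y : V d) : cc N x y ≤ S := by
  simpa using h.cc_fin x {y}

lemma Dom.ham_osc {Φ : Interaction d} {N : Finset (V d) → ℝ} {S : ℝ} (h : Dom Φ N S)
    (x y : V d) (ω ω' : Config d) (hω : ∀ z, z ≠ y → ω z = ω' z) :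
    |ham Φ {x} ω - ham Φ {x} ω'| ≤ 2 * cc N x y := by
  unfold ham cc
  rw [← (h.meet_sm {x} ω).tsum_sub (h.meet_sm {x} ω'), ← tsum_mul_left, ← Real.norm_eq_abs]
  refine tsum_of_norm_bounded ((h.cc_sm x y).mul_left 2).hasSum (fun Δ => ?_)
  by_cases hx : x ∈ Δ
  · have hne : (Δ ∩ {x}).Nonempty := ⟨x, by simp [hx]⟩
    simp only [hne, if_true]
    by_cases hy : y ∈ Δ
    · simp only [hx, hy, and_self, if_true, Real.norm_eq_abs]
      have h1 := abs_le.1 (h.bd Δ ω)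
      have h2 := abs_le.1 (h.bd Δ ω')
      rw [abs_le]
      constructor <;> linarith
    · have : Φ Δ ω = Φ Δ ω' := h.loc Δ ω ω' (fun z hz => hω z (fun e => hy (e ▸ hz)))
      simp [this, hy]
  · have hne : ¬ (Δ ∩ {x}).Nonempty := by
      rintro ⟨z, hz⟩
      rw [Finset.mem_inter, Finset.mem_singleton] at hz
      exact hx (hz.2 ▸ hz.1)
    simp [hx]

lemma gibbs_ratio (Φ : Interaction d) (Λ : Finset (V d)) (ω ω' : Config d) (t : ℝ)
    (ht : ∀ f, |ham Φ Λ (fill Λ f ω) - ham Φ Λ (fill Λ f ω')| ≤ t) (f : ↥Λ → Bool) :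
    finGibbs Φ Λ ω f ≤ Real.exp (2 * t) * finGibbs Φ Λ ω' f := by
  have hz : gibbsZ Φ Λ ω' ≤ Real.exp t * gibbsZ Φ Λ ω := by
    unfold gibbsZ
    rw [Finset.mul_sum]
    refine Finset.sum_le_sum (fun f _ => ?_)
    rw [← Real.exp_add]
    refine Real.exp_le_exp.2 ?_
    have := abs_le.1 (ht f)
    linarith
  have hn : Real.exp (-(ham Φ Λ (fill Λ f ω))) ≤
      Real.exp t * Real.exp (-(ham Φ Λ (fill Λ f ω'))) := by
    rw [← Real.exp_add]
    refine Real.exp_le_exp.2 ?_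
    have := abs_le.1 (ht f)
    linarith
  unfold finGibbs
  rw [div_le_iff₀ (gibbsZ_pos _ _ _), ← mul_div_assoc, div_mul_eq_mul_div,
    le_div_iff₀ (gibbsZ_pos _ _ _)]
  have he : Real.exp (2 * t) = Real.exp t * Real.exp t := by rw [← Real.exp_add]; ring_nf
  calc _ ≤ (Real.exp t * Real.exp (-(ham Φ Λ (fill Λ f ω')))) *
        (Real.exp t * gibbsZ Φ Λ ω) :=
        mul_le_mul hn hz (gibbsZ_pos _ _ _).le
          (mul_nonneg (Real.exp_pos _).le (Real.exp_pos _).le)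
    _ = _ := by rw [he]; ring

lemma gibbs_diff (Φ : Interaction d) (Λ : Finset (V d)) (ω ω' : Config d) (t : ℝ)
    (ht : ∀ f, |ham Φ Λ (fill Λ f ω) - ham Φ Λ (fill Λ f ω')| ≤ t) :
    ∑ f, |finGibbs Φ Λ ω f - finGibbs Φ Λ ω' f| ≤ 2 * (Real.exp (2 * t) - 1) := by
  have ht0 : 0 ≤ t := (abs_nonneg _).trans (ht (fun _ => true))
  have he : 1 ≤ Real.exp (2 * t) := Real.one_le_exp (by linarith)
  calc ∑ f, |finGibbs Φ Λ ω f - finGibbs Φ Λ ω' f|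
      ≤ ∑ f, (Real.exp (2 * t) - 1) * (finGibbs Φ Λ ω f + finGibbs Φ Λ ω' f) := by
        refine Finset.sum_le_sum (fun f _ => ?_)
        have h1 := gibbs_ratio Φ Λ ω ω' t ht f
        have h2 := gibbs_ratio Φ Λ ω' ω t (fun f => by rw [abs_sub_comm]; exact ht f) f
        have p1 := mul_nonneg (sub_nonneg.2 he) (finGibbs_nonneg Φ Λ ω f)
        have p2 := mul_nonneg (sub_nonneg.2 he) (finGibbs_nonneg Φ Λ ω' f)
        rw [abs_le]
        constructor <;> nlinarith
    _ = 2 * (Real.exp (2 * t) - 1) := by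
        rw [← Finset.mul_sum, Finset.sum_add_distrib, finGibbs_sum, finGibbs_sum]; ring

lemma fill_congr_off (Λ : Finset (V d)) (f : ↥Λ → Bool) (ω ω' : Config d) (y : V d)
    (hω : ∀ z, z ≠ y → ω z = ω' z) (z : V d) (hz : z ≠ y) :
    fill Λ f ω z = fill Λ f ω' z := by
  unfold fill
  split_ifs
  · rfl
  · exact hω z hz

lemma Dom.gam_osc {Φ : Interaction d} {N : Finset (V d) → ℝ} {S : ℝ} (h : Dom Φ N S)
    (hS : S ≤ 1 / 32) (x : V d) {f : Config d → ℝ} {b : V d → ℝ} (hf : OscB f b) :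
    OscB (gam Φ {x} f) (fun y => if y = x then 0 else b y + 16 * cc N x y * b x) := by
  intro y ω ω' hω
  by_cases hyx : y = x
  · subst hyx
    have hfill : ∀ s : ↥({y} : Finset (V d)) → Bool, fill {y} s ω = fill {y} s ω' := by
      intro s
      funext z
      unfold fill
      split_ifs with hz
      · rfl
      · exact hω z (by simpa using hz)
    have : gam Φ {y} f ω = gam Φ {y} f ω' := by
      unfold gam finGibbs gibbsZ
      simp only [hfill]
    simp [this]
  · simp only [hyx, if_false]
    set t := 2 * cc N x y with ht
    have hcn := h.cc_nn x y
    have hcl := h.cc_le x y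
    have hd := gibbs_diff Φ {x} ω ω' t
      (fun s => h.ham_osc x y _ _ (fill_congr_off _ s ω ω' y hω))
    have he : Real.exp (2 * t) - 1 ≤ 2 * (2 * t) := by
      have h2 : |2 * t| ≤ 1 := by rw [abs_le]; constructor <;> linarith
      have := Real.abs_exp_sub_one_le h2
      rw [abs_of_nonneg (a := 2 * t) (by linarith)] at this
      exact (le_abs_self _).trans this
    have hdec : gam Φ {x} f ω - gam Φ {x} f ω' =
        ∑ s, finGibbs Φ {x} ω s * (f (fill {x} s ω) - f (fill {x} s ω')) +
        ∑ s, (finGibbs Φ {x} ω s - finGibbs Φ {x} ω' s) * (f (fill {x} s ω') - f ω') := by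
      have e1 : ∑ s, (finGibbs Φ {x} ω s - finGibbs Φ {x} ω' s) * f ω' = 0 := by
        rw [← Finset.sum_mul, Finset.sum_sub_distrib, finGibbs_sum, finGibbs_sum]; ring
      rw [← add_zero (∑ s, finGibbs Φ {x} ω s * _ + _), ← e1]
      unfold gam
      rw [← Finset.sum_sub_distrib, ← Finset.sum_add_distrib, ← Finset.sum_add_distrib]
      refine Finset.sum_congr rfl (fun s _ => ?_)
      ring
    rw [hdec]
    refine (abs_add_le _ _).trans (add_le_add ?_ ?_)
    · calc _ ≤ ∑ s, |finGibbs Φ {x} ω s * (f (fill {x} s ω) - f (fill {x} s ω'))| :=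
            Finset.abs_sum_le_sum_abs _ _
        _ ≤ ∑ s, finGibbs Φ {x} ω s * b y := by
            refine Finset.sum_le_sum (fun s _ => ?_)
            rw [abs_mul, abs_of_nonneg (finGibbs_nonneg _ _ _ _)]
            exact mul_le_mul_of_nonneg_left
              (hf y _ _ (fill_congr_off _ s ω ω' y hω)) (finGibbs_nonneg _ _ _ _)
        _ = b y := by rw [← Finset.sum_mul, finGibbs_sum, one_mul]
    · calc _ ≤ ∑ s, |(finGibbs Φ {x} ω s - finGibbs Φ {x} ω' s) * (f (fill {x} s ω') - f ω')| :=
            Finset.abs_sum_le_sum_abs _ _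
        _ ≤ ∑ s, |finGibbs Φ {x} ω s - finGibbs Φ {x} ω' s| * b x := by
            refine Finset.sum_le_sum (fun s _ => ?_)
            rw [abs_mul]
            refine mul_le_mul_of_nonneg_left ?_ (abs_nonneg _)
            exact hf x _ _ (fun z hz => fill_off _ _ _ (by simpa using hz))
        _ ≤ 16 * cc N x y * b x := by
            rw [← Finset.sum_mul]
            refine mul_le_mul_of_nonneg_right ?_ (hf.nn x)
            linarith

lemma cont_int {g : Config d → ℝ} (hg : Continuous g) (σ : Measure (Config d))
    [IsProbabilityMeasure σ] : Integrable g σ :=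
  hg.integrable_of_hasCompactSupport (HasCompactSupport.of_compactSpace g)

lemma int_close {g g' : Config d → ℝ} (hg : Continuous g) (hg' : Continuous g')
    (σ : Measure (Config d)) [IsProbabilityMeasure σ] {ε : ℝ} (h : ∀ ω, |g ω - g' ω| ≤ ε) :
    |∫ ω, g ω ∂σ - ∫ ω, g' ω ∂σ| ≤ ε := by
  rw [← integral_sub (cont_int hg σ) (cont_int hg' σ), ← Real.norm_eq_abs]
  have := norm_integral_le_of_norm_le_const (μ := σ) (f := fun ω => g ω - g' ω) (C := ε)
    (Eventually.of_forall (fun ω => h ω))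
  simpa using this

lemma cyl_meas (Λ : Finset (V d)) (f : ↥Λ → Bool) : MeasurableSet (cyl Λ f) := by
  have : cyl Λ f = ⋂ x : ↥Λ, (fun ξ : Config d => ξ x) ⁻¹' {f x} := by
    ext ξ
    simp [cyl]
  rw [this]
  exact MeasurableSet.iInter (fun x => measurable_pi_apply _ (measurableSet_singleton _))

lemma mem_cyl (Λ : Finset (V d)) (f : ↥Λ → Bool) (ξ : Config d) :
    ξ ∈ cyl Λ f ↔ rst Λ ξ = f := by
  constructor
  · intro h
    funext x
    exact h x x.2
  · rintro rfl x hx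
    rfl

open scoped Classical in
lemma loc_integral (Λ : Finset (V d)) (k : (↥Λ → Bool) → ℝ) (σ : Measure (Config d))
    [IsProbabilityMeasure σ] :
    ∫ ω, k (rst Λ ω) ∂σ = ∑ f, k f * (σ (cyl Λ f)).toReal := by
  have h1 : ∀ ω, k (rst Λ ω) = ∑ f, (cyl Λ f).indicator (fun _ => k f) ω := by
    intro ω
    simp only [Set.indicator_apply, mem_cyl]
    simp
  simp only [h1]
  rw [integral_finsetSum _ (fun f _ => (integrable_const _).indicator (cyl_meas Λ f))]
  refine Finset.sum_congr rfl (fun f _ => ?_)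
  rw [integral_indicator (cyl_meas Λ f), setIntegral_const]
  simp [Measure.real, mul_comm]

lemma rst_loc_cont (Λ : Finset (V d)) (k : (↥Λ → Bool) → ℝ) :
    Continuous (fun ω => k (rst Λ ω)) := by
  refine local_continuous (Λ := Λ) (fun ω ω' h => ?_)
  have : rst Λ ω = rst Λ ω' := by
    funext x
    exact h x x.2
  rw [this]

lemma Dom.approx {Φ : Interaction d} {N : Finset (V d) → ℝ} {S : ℝ} (h : Dom Φ N S)
    (Λ : Finset (V d)) (σ ν : Measure (Config d)) [IsProbabilityMeasure σ]
    [IsProbabilityMeasure ν]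
    (hν : ∀ f : ↥Λ → Bool, (σ (cyl Λ f)).toReal = ∫ η, finGibbs Φ Λ η f ∂ν)
    {g : Config d → ℝ} (hg : Continuous g) {ε : ℝ}
    (hε : ∀ ω ω' : Config d, (∀ x ∈ Λ, ω x = ω' x) → |g ω - g ω'| ≤ ε) :
    |∫ ω, g ω ∂σ - ∫ η, gam Φ Λ g η ∂ν| ≤ 2 * ε := by
  have h1 := int_close hg (rst_loc_cont Λ (fun f => g (fill Λ f plusC))) σ (ε := ε)
    (fun ω => hε _ _ (fun x hx => by rw [fill_on _ _ _ hx]; rfl))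
  have h2 : ∫ ω, g (fill Λ (rst Λ ω) plusC) ∂σ =
      ∫ η, ∑ f, finGibbs Φ Λ η f * g (fill Λ f plusC) ∂ν := by
    rw [loc_integral Λ (fun f => g (fill Λ f plusC)) σ,
      integral_finsetSum _ (fun f _ => (cont_int (h.finGibbs_cont Λ f) ν).mul_const _)]
    refine Finset.sum_congr rfl (fun f _ => ?_)
    rw [hν f, integral_mul_const, mul_comm]
  have h3 := int_close (g := fun η => ∑ f, finGibbs Φ Λ η f * g (fill Λ f plusC))
    (g' := gam Φ Λ g)
    (continuous_finsetSum _ (fun f _ => (h.finGibbs_cont Λ f).mul continuous_const))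
    (h.gam_cont Λ hg) ν (ε := ε) (fun η => by
      unfold gam
      rw [← Finset.sum_sub_distrib]
      calc _ ≤ ∑ f, |finGibbs Φ Λ η f * g (fill Λ f plusC) - finGibbs Φ Λ η f * g (fill Λ f η)| :=
            Finset.abs_sum_le_sum_abs _ _
        _ ≤ ∑ f, finGibbs Φ Λ η f * ε := by
            refine Finset.sum_le_sum (fun s _ => ?_)
            rw [← mul_sub, abs_mul, abs_of_nonneg (finGibbs_nonneg _ _ _ _)]
            refine mul_le_mul_of_nonneg_left (hε _ _ (fun x hx => ?_)) (finGibbs_nonneg _ _ _ _)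
            rw [fill_on _ _ _ hx, fill_on _ _ _ hx]
        _ = ε := by rw [← Finset.sum_mul, finGibbs_sum, one_mul])
  rw [h2] at h1
  calc _ ≤ _ := abs_sub_le _ (∫ η, ∑ f, finGibbs Φ Λ η f * g (fill Λ f plusC) ∂ν) _
    _ ≤ 2 * ε := by linarith

/-- The coefficients for the updated oscillation are summable, with the expected bound. -/
lemma Dom.upd {Φ : Interaction d} {N : Finset (V d) → ℝ} {S : ℝ} (h : Dom Φ N S)
    (hS : S ≤ 1 / 32) (x : V d) {b : V d → ℝ} (hb : Summable b) (hb0 : ∀ y, 0 ≤ b y) :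
    Summable (fun y => if y = x then 0 else b y + 16 * cc N x y * b x) ∧
    ∑' y, (if y = x then 0 else b y + 16 * cc N x y * b x) ≤ ∑' y, b y - (1 / 2) * b x := by
  have hs1 : Summable (fun y => if y = x then b x else 0) :=
    summable_of_ne_finset_zero (s := {x}) (fun y hy => by
      rw [if_neg (by simpa using hy)])
  have hs2 : Summable (fun y => 16 * cc N x y * b x) :=
    ((h.cc_summable x).mul_left 16).mul_right _
  have hs3 : Summable (fun y => (b y - (if y = x then b x else 0)) + 16 * cc N x y * b x) :=
    (hb.sub hs1).add hs2
  have hle : ∀ y, (if y = x then 0 else b y + 16 * cc N x y * b x) ≤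
      (b y - (if y = x then b x else 0)) + 16 * cc N x y * b x := by
    intro y
    have := mul_nonneg (mul_nonneg (by norm_num : (0:ℝ) ≤ 16) (h.cc_nn x y)) (hb0 x)
    by_cases hy : y = x
    · subst hy; simpa using this
    · simp [hy]
  have hnn : ∀ y, 0 ≤ (if y = x then 0 else b y + 16 * cc N x y * b x) := by
    intro y
    have := mul_nonneg (mul_nonneg (by norm_num : (0:ℝ) ≤ 16) (h.cc_nn x y)) (hb0 x)
    have := hb0 y
    split_ifs <;> linarith
  have hs := Summable.of_nonneg_of_le hnn hle hs3
  refine ⟨hs, (hs.tsum_le_tsum hle hs3).trans ?_⟩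
  rw [(hb.sub hs1).tsum_add hs2, hb.tsum_sub hs1, tsum_ite_eq, tsum_mul_right, tsum_mul_left]
  have h1 := h.cc_tsum x
  nlinarith [hb0 x, mul_nonneg (hb0 x) (sub_nonneg.2 (h1.trans hS))]

lemma Dom.gibbs_inv {Φ : Interaction d} {N : Finset (V d) → ℝ} {S : ℝ} (h : Dom Φ N S)
    (hS : S ≤ 1 / 32) {σ : Measure (Config d)} (hσ : IsGibbs Φ σ) (x : V d)
    {f : Config d → ℝ} {b : V d → ℝ} (hf : Continuous f) (hb : Summable b) (ho : OscB f b) :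
    ∫ ω, gam Φ {x} f ω ∂σ = ∫ ω, f ω ∂σ := by
  have := hσ.1
  obtain ⟨hb', -⟩ := h.upd hS x hb ho.nn
  have ho' := h.gam_osc hS x ho
  have hf' := h.gam_cont {x} hf
  set b' : V d → ℝ := fun y => if y = x then 0 else b y + 16 * cc N x y * b x with hb'def
  have hlim : ∀ {c : V d → ℝ}, Summable c →
      Tendsto (fun Λ => ∑' y, c y - ∑ y ∈ Λ, c y) atTop (𝓝 0) := by
    intro c hc
    have : Tendsto (fun Λ : Finset (V d) => ∑' y, c y - ∑ y ∈ Λ, c y) atTop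
      (𝓝 (∑' y, c y - ∑' y, c y)) := tendsto_const_nhds.sub hc.hasSum
    simpa using this
  have hbound : ∀ᶠ Λ : Finset (V d) in atTop,
      |∫ ω, gam Φ {x} f ω ∂σ - ∫ ω, f ω ∂σ| ≤
        2 * (∑' y, b' y - ∑ y ∈ Λ, b' y) + 2 * (∑' y, b y - ∑ y ∈ Λ, b y) := by
    filter_upwards [eventually_ge_atTop ({x} : Finset (V d))] with Λ hΛ
    obtain ⟨ν, hνp, hν⟩ := hσ.2 Λ
    have h1 := h.approx Λ σ ν hν hf (ho.osc_le hf hb Λ)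
    have h2 := h.approx Λ σ ν hν hf' (ho'.osc_le hf' hb' Λ)
    have h3 : (fun η => gam Φ Λ (gam Φ {x} f) η) = fun η => gam Φ Λ f η :=
      funext (fun η => h.consistent hΛ f η)
    rw [h3] at h2
    rw [abs_sub_comm] at h1
    exact (abs_sub_le _ (∫ η, gam Φ Λ f η ∂ν) _).trans (add_le_add h2 h1)
  have hl : Tendsto (fun Λ : Finset (V d) =>
      2 * (∑' y, b' y - ∑ y ∈ Λ, b' y) + 2 * (∑' y, b y - ∑ y ∈ Λ, b y)) atTop (𝓝 0) := by
    simpa using ((hlim hb').const_mul 2).add ((hlim hb).const_mul 2)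
  have := ge_of_tendsto hl hbound
  have := abs_nonpos_iff.1 this
  linarith

lemma Dom.contract {Φ : Interaction d} {N : Finset (V d) → ℝ} {S : ℝ} (h : Dom Φ N S)
    (hS : S ≤ 1 / 32) {σ σ' : Measure (Config d)} (hσ : IsGibbs Φ σ) (hσ' : IsGibbs Φ σ')
    {A : ℝ} (hA : 0 ≤ A)
    (est : ∀ (f : Config d → ℝ) (b : V d → ℝ), Continuous f → Summable b → OscB f b →
      |∫ ω, f ω ∂σ - ∫ ω, f ω ∂σ'| ≤ A * ∑' y, b y)
    (F : Finset (V d)) : ∀ (f : Config d → ℝ) (b : V d → ℝ), Continuous f → Summable b →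
      OscB f b → |∫ ω, f ω ∂σ - ∫ ω, f ω ∂σ'| ≤ A * (∑' y, b y - (1 / 2) * ∑ y ∈ F, b y) := by
  induction F using Finset.induction_on with
  | empty =>
    intro f b hf hb ho
    simpa using est f b hf hb ho
  | insert x F hx ih =>
    intro f b hf hb ho
    obtain ⟨hb', hle⟩ := h.upd hS x hb ho.nn
    have h1 := ih (gam Φ {x} f) _ (h.gam_cont {x} hf) hb' (h.gam_osc hS x ho)
    rw [h.gibbs_inv hS hσ x hf hb ho, h.gibbs_inv hS hσ' x hf hb ho] at h1
    refine h1.trans (mul_le_mul_of_nonneg_left ?_ hA)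
    rw [Finset.sum_insert hx]
    have h2 : ∑ y ∈ F, b y ≤ ∑ y ∈ F, (if y = x then 0 else b y + 16 * cc N x y * b x) := by
      refine Finset.sum_le_sum (fun y hy => ?_)
      have hyx : y ≠ x := fun e => hx (e ▸ hy)
      rw [if_neg hyx]
      have := mul_nonneg (mul_nonneg (by norm_num : (0:ℝ) ≤ 16) (h.cc_nn x y)) (ho.nn x)
      linarith
    linarith

lemma Dom.est {Φ : Interaction d} {N : Finset (V d) → ℝ} {S : ℝ} (h : Dom Φ N S)
    (hS : S ≤ 1 / 32) {σ σ' : Measure (Config d)} (hσ : IsGibbs Φ σ) (hσ' : IsGibbs Φ σ')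
    (n : ℕ) : ∀ (f : Config d → ℝ) (b : V d → ℝ), Continuous f → Summable b → OscB f b →
      |∫ ω, f ω ∂σ - ∫ ω, f ω ∂σ'| ≤ (1 / 2 : ℝ) ^ n * (2 * ∑' y, b y) := by
  have := hσ.1
  have := hσ'.1
  induction n with
  | zero =>
    intro f b hf hb ho
    have key : ∀ (τ : Measure (Config d)) [IsProbabilityMeasure τ],
        |∫ ω, f ω ∂τ - f plusC| ≤ ∑' y, b y := by
      intro τ _
      have := int_close hf (continuous_const (y := f plusC)) τ (ε := ∑' y, b y)
        (fun ω => by simpa using ho.osc_le hf hb ∅ ω plusC (by simp))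
      simpa using this
    have h1 := abs_le.1 (key σ)
    have h2 := abs_le.1 (key σ')
    rw [abs_le]
    constructor <;> linarith
  | succ n ih =>
    intro f b hf hb ho
    have h1 := h.contract hS hσ hσ' (A := (1 / 2 : ℝ) ^ n * 2) (by positivity)
      (fun f b hf hb ho => by rw [mul_assoc]; exact ih f b hf hb ho)
    have hl : Tendsto (fun F : Finset (V d) =>
        (1 / 2 : ℝ) ^ n * 2 * (∑' y, b y - (1 / 2) * ∑ y ∈ F, b y)) atTop
        (𝓝 ((1 / 2 : ℝ) ^ n * 2 * (∑' y, b y - (1 / 2) * ∑' y, b y))) :=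
      (tendsto_const_nhds.sub (hb.hasSum.const_mul _)).const_mul _
    have h2 := ge_of_tendsto' hl (fun F => h1 F f b hf hb ho)
    refine h2.trans (le_of_eq ?_)
    rw [pow_succ]
    ring

lemma Dom.int_eq {Φ : Interaction d} {N : Finset (V d) → ℝ} {S : ℝ} (h : Dom Φ N S)
    (hS : S ≤ 1 / 32) {σ σ' : Measure (Config d)} (hσ : IsGibbs Φ σ) (hσ' : IsGibbs Φ σ')
    {f : Config d → ℝ} {b : V d → ℝ} (hf : Continuous f) (hb : Summable b) (ho : OscB f b) :
    ∫ ω, f ω ∂σ = ∫ ω, f ω ∂σ' := by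
  have hl : Tendsto (fun n : ℕ => (1 / 2 : ℝ) ^ n * (2 * ∑' y, b y)) atTop (𝓝 0) := by
    simpa using (tendsto_pow_atTop_nhds_zero_of_lt_one (r := (1 / 2 : ℝ)) (by norm_num)
      (by norm_num)).mul_const (2 * ∑' y, b y)
  have := ge_of_tendsto' hl (fun n => h.est hS hσ hσ' n f b hf hb ho)
  have := abs_nonpos_iff.1 this
  linarith

open scoped Classical in
lemma Dom.unique {Φ : Interaction d} {N : Finset (V d) → ℝ} {S : ℝ} (h : Dom Φ N S)
    (hS : S ≤ 1 / 32) {σ σ' : Measure (Config d)} (hσ : IsGibbs Φ σ) (hσ' : IsGibbs Φ σ') :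
    σ = σ' := by
  have := hσ.1
  have := hσ'.1
  refine ext_of_generate_finite (measurableCylinders (fun _ : V d => Bool))
    generateFrom_measurableCylinders.symm isPiSystem_measurableCylinders ?_ (by simp)
  intro s hs
  obtain ⟨Λ, T, hT, rfl⟩ := (mem_measurableCylinders s).1 hs
  have hm : MeasurableSet (cylinder (α := fun _ : V d => Bool) Λ T) := hT.cylinder Λ
  have hind : ∀ ω ω' : Config d, (∀ x ∈ Λ, ω x = ω' x) →
      (cylinder (α := fun _ : V d => Bool) Λ T).indicator (fun _ => (1:ℝ)) ω =
        (cylinder (α := fun _ : V d => Bool) Λ T).indicator (fun _ => (1:ℝ)) ω' := by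
    intro ω ω' he
    have : Λ.restrict ω = Λ.restrict ω' := by
      funext x
      exact he x x.2
    have : ω ∈ cylinder (α := fun _ : V d => Bool) Λ T ↔ ω' ∈ cylinder (α := fun _ : V d => Bool) Λ T := by
      rw [mem_cylinder, mem_cylinder, this]
    simp [Set.indicator_apply, this]
  have hi := h.int_eq hS hσ hσ' (f := (cylinder (α := fun _ : V d => Bool) Λ T).indicator (fun _ => (1:ℝ)))
    (b := fun y => if y ∈ Λ then 1 else 0) (local_continuous hind)
    (summable_of_ne_finset_zero (s := Λ) (fun y hy => if_neg hy)) (by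
      intro y ω ω' he
      by_cases hy : y ∈ Λ
      · simp only [hy, if_true, Set.indicator_apply]
        split_ifs <;> simp
      · rw [hind ω ω' (fun x hx => he x (fun e => hy (e ▸ hx)))]
        simp [hy])
  rw [integral_indicator hm, integral_indicator hm] at hi
  simp only [setIntegral_const, smul_eq_mul, mul_one, Measure.real] at hi
  exact (ENNReal.toReal_eq_toReal_iff' (measure_ne_top _ _) (measure_ne_top _ _)).1 hi

/-- Finite-volume Gibbs measure with plus boundary condition as a measure on configurations. -/
def finMeas (Φ : Interaction d) (Λ : Finset (V d)) : Measure (Config d) :=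
  ∑ f : ↥Λ → Bool, ENNReal.ofReal (finGibbs Φ Λ plusC f) • Measure.dirac (fill Λ f plusC)

lemma finMeas_prob (Φ : Interaction d) (Λ : Finset (V d)) :
    IsProbabilityMeasure (finMeas Φ Λ) := by
  constructor
  simp only [finMeas, Measure.finsetSum_apply, Measure.smul_apply, measure_univ, smul_eq_mul,
    mul_one]
  rw [← ENNReal.ofReal_sum_of_nonneg (fun f _ => finGibbs_nonneg _ _ _ _), finGibbs_sum]
  simp

lemma finMeas_int (Φ : Interaction d) (Λ : Finset (V d)) {g : Config d → ℝ}
    (hg : Continuous g) : ∫ ω, g ω ∂(finMeas Φ Λ) = gam Φ Λ g plusC := by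
  unfold finMeas gam
  rw [integral_finsetSum_measure]
  · refine Finset.sum_congr rfl (fun f _ => ?_)
    rw [integral_smul_measure, integral_dirac, ENNReal.toReal_ofReal (finGibbs_nonneg _ _ _ _),
      smul_eq_mul]
  · intro f _
    exact (cont_int hg _).smul_measure ENNReal.ofReal_ne_top

lemma Dom.exists_gibbs {Φ : Interaction d} {N : Finset (V d) → ℝ} {S : ℝ} (h : Dom Φ N S) :
    ∃ σ, IsGibbs Φ σ := by
  let m : Finset (V d) → ProbabilityMeasure (Config d) := fun Λ => ⟨finMeas Φ Λ, finMeas_prob Φ Λ⟩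
  let U : Ultrafilter (Finset (V d)) := Ultrafilter.of atTop
  have hU : (U : Filter (Finset (V d))) ≤ atTop := Ultrafilter.of_le atTop
  obtain ⟨σ, -, hσ⟩ := isCompact_univ.ultrafilter_le_nhds (U.map m) (by simp)
  have hσ' : Tendsto m U (𝓝 σ) := hσ
  rw [ProbabilityMeasure.tendsto_iff_forall_integral_tendsto] at hσ'
  have hlim : ∀ g : Config d → ℝ, Continuous g →
      Tendsto (fun Λ => ∫ ω, g ω ∂(finMeas Φ Λ)) U (𝓝 (∫ ω, g ω ∂(σ : Measure (Config d)))) :=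
    fun g hg => hσ' (BoundedContinuousFunction.mkOfCompact ⟨g, hg⟩)
  refine ⟨σ, inferInstance, fun Λ => ⟨σ, inferInstance, fun f => ?_⟩⟩
  classical
  let k : (↥Λ → Bool) → ℝ := fun f' => if f' = f then 1 else 0
  have h1 := loc_integral Λ k (σ : Measure (Config d))
  have h2 : ∑ f', k f' * ((σ : Measure (Config d)) (cyl Λ f')).toReal =
      ((σ : Measure (Config d)) (cyl Λ f)).toReal := by simp [k]
  have h3 : gam Φ Λ (fun ω => k (rst Λ ω)) = fun η => finGibbs Φ Λ η f := by
    funext η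
    simp [gam, rst_fill, k]
  have hk := rst_loc_cont Λ k
  have l1 := hlim _ hk
  have l2 := hlim _ (h.gam_cont Λ hk)
  have hev : (fun Λ' => ∫ ω, k (rst Λ ω) ∂(finMeas Φ Λ')) =ᶠ[(U : Filter (Finset (V d)))]
      fun Λ' => ∫ ω, gam Φ Λ (fun ω => k (rst Λ ω)) ω ∂(finMeas Φ Λ') := by
    filter_upwards [hU (eventually_ge_atTop Λ)] with Λ' hΛ'
    rw [finMeas_int Φ Λ' hk, finMeas_int Φ Λ' (h.gam_cont Λ hk), h.consistent hΛ']
  have h4 := tendsto_nhds_unique (l1.congr' hev) l2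
  rw [← h2, ← h1, h4, h3]

/-- The indicator that `Δ` is a nearest-neighbour edge. -/
def edg (Δ : Finset (V d)) : ℝ :=
  if Δ.card = 2 ∧ ∀ x ∈ Δ, ∀ y ∈ Δ, x ≠ y → dist1 x y = 1 then 1 else 0

lemma ising_bd (β : ℝ) (hβ : 0 < β) (Δ : Finset (V d)) (ω : Config d) :
    |ising β Δ ω| ≤ β * edg Δ := by
  unfold ising edg
  split_ifs
  · rw [abs_mul, Finset.abs_prod, Finset.prod_eq_one, abs_neg, abs_of_pos hβ]
    intro x _
    unfold spin
    split_ifs <;> simp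
  · simp

lemma ising_local (β : ℝ) : IsLocal (ising β : Interaction d) := by
  intro Δ ω ω' h
  unfold ising
  rw [Finset.prod_congr rfl (fun x hx => by rw [h x hx])]

lemma supNorm_bd {Ψ : Interaction d} (h : IsLocal Ψ) (Δ : Finset (V d)) (ω : Config d) :
    |Ψ Δ ω| ≤ supNorm Ψ Δ := by
  have hc : Continuous (fun ω => |Ψ Δ ω|) := (local_continuous (h Δ)).abs
  exact le_ciSup (isCompact_range hc).bddAbove ω

lemma supNorm_trans {Ψ : Interaction d} (h : TransInv Ψ) (a : V d) (Δ : Finset (V d)) :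
    supNorm Ψ (Δ.image (fun x => x - a)) = supNorm Ψ Δ := by
  unfold supNorm
  symm
  refine Function.Surjective.iSup_congr (translate a) (fun ω => ⟨translate (-a) ω, ?_⟩) ?_
  · funext x
    simp [translate]
  · intro ω
    rw [h a Δ ω]

lemma edg_trans (a : V d) (Δ : Finset (V d)) :
    edg (Δ.image (fun x => x - a)) = edg Δ := by
  unfold edg
  rw [Finset.card_image_of_injective _ (sub_left_injective)]
  refine if_congr ?_ rfl rfl
  simp [dist1]

lemma distInf_le_diam {Δ : Finset (V d)} {x y : V d} (hx : x ∈ Δ) (hy : y ∈ Δ) :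
    distInf x y ≤ diam Δ :=
  (Finset.le_sup (f := fun y => distInf x y) hy).trans
    (Finset.le_sup (f := fun x => Δ.sup fun y => distInf x y) hx)

lemma card_le_diam (Δ : Finset (V d)) : Δ.card ≤ (diam Δ + 1) ^ d := by
  rcases Δ.eq_empty_or_nonempty with rfl | hne
  · simp
  have h1 : Δ ⊆ Fintype.piFinset (fun i : Fin d => Δ.image (fun x => x i)) := by
    intro x hx
    rw [Fintype.mem_piFinset]
    exact fun i => Finset.mem_image_of_mem _ hx
  refine (Finset.card_le_card h1).trans ?_
  rw [Fintype.card_piFinset]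
  refine (Finset.prod_le_pow_card _ _ (diam Δ + 1) (fun i _ => ?_)).trans (by simp)
  have hne' : (Δ.image (fun x => x i)).Nonempty := hne.image _
  set M := Δ.image (fun x => x i) with hM
  have h2 : M ⊆ Finset.Icc (M.min' hne') (M.max' hne') := fun z hz =>
    Finset.mem_Icc.2 ⟨Finset.min'_le _ _ hz, Finset.le_max' _ _ hz⟩
  refine (Finset.card_le_card h2).trans ?_
  rw [Int.card_Icc]
  obtain ⟨x, hx, hx'⟩ := Finset.mem_image.1 (M.max'_mem hne')
  obtain ⟨y, hy, hy'⟩ := Finset.mem_image.1 (M.min'_mem hne')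
  have h3 : (x i - y i).natAbs ≤ diam Δ :=
    (Finset.le_sup (f := fun i => (x i - y i).natAbs) (Finset.mem_univ i)).trans
      (distInf_le_diam hx hy)
  omega

/-- Edge weights at the origin. -/
def edg0 (Δ : Finset (V d)) : ℝ := if (0 : V d) ∈ Δ then (Δ.card : ℝ) * edg Δ else 0

lemma edg0_sm : Summable (edg0 (d := d)) := by
  refine summable_of_ne_finset_zero
    (s := (Finset.Icc (fun _ => -1 : V d) (fun _ => 1)).powerset) (fun Δ hΔ => ?_)
  unfold edg0 edg
  by_cases h0 : (0 : V d) ∈ Δ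
  · rw [if_pos h0, if_neg, mul_zero]
    rintro ⟨-, h⟩
    refine hΔ (Finset.mem_powerset.2 (fun z hz => ?_))
    have hz1 : ∀ i, (z i).natAbs ≤ 1 := by
      intro i
      by_cases hz0 : z = 0
      · simp [hz0]
      · have h1 := h z hz 0 h0 hz0
        unfold dist1 at h1
        have h2 := Finset.single_le_sum (f := fun i => (z i - (0 : V d) i).natAbs)
          (fun _ _ => Nat.zero_le _) (Finset.mem_univ i)
        rw [h1] at h2
        simpa using h2
    rw [Finset.mem_Icc]
    constructor
    · intro i
      have := hz1 i
      show -1 ≤ z i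
      omega
    · intro i
      have := hz1 i
      show z i ≤ 1
      omega
  · rw [if_neg h0]

lemma dom_main (β : ℝ) (hβ : 0 < β) (Ψ : Interaction d) (hl : IsLocal Ψ) (ht : TransInv Ψ)
    (hs : DSummable Ψ) :
    Dom (Iadd (ising β) Ψ) (fun Δ => β * edg Δ + supNorm Ψ Δ)
      (β * ∑' Δ, edg0 (d := d) Δ + dnorm Ψ) := by
  set N : Finset (V d) → ℝ := fun Δ => β * edg Δ + supNorm Ψ Δ with hN
  have hbd : ∀ Δ ω, |Iadd (ising β) Ψ Δ ω| ≤ N Δ := fun Δ ω =>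
    (abs_add_le _ _).trans (add_le_add (ising_bd β hβ Δ ω) (supNorm_bd hl Δ ω))
  have hnn : ∀ Δ, 0 ≤ N Δ := fun Δ => (abs_nonneg _).trans (hbd Δ plusC)
  have hΨn : ∀ Δ, 0 ≤ supNorm Ψ Δ := fun Δ => (abs_nonneg _).trans (supNorm_bd hl Δ plusC)
  have hle : ∀ Δ : Finset (V d), (if (0 : V d) ∈ Δ then (Δ.card : ℝ) * N Δ else 0) ≤
      β * edg0 Δ + dTerm Ψ Δ := by
    intro Δ
    unfold edg0 dTerm
    split_ifs
    · have h1 : (Δ.card : ℝ) ≤ ((diam Δ + 1 : ℕ) : ℝ) ^ d := by exact_mod_cast card_le_diam Δ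
      have h2 := mul_le_mul_of_nonneg_right h1 (hΨn Δ)
      simp only [hN]
      linarith
    · simp
  have hsum0 : Summable (fun Δ : Finset (V d) => β * edg0 Δ + dTerm Ψ Δ) :=
    (edg0_sm.mul_left β).add hs
  have hsm : Summable (fun Δ : Finset (V d) =>
      if (0 : V d) ∈ Δ then (Δ.card : ℝ) * N Δ else 0) := by
    refine Summable.of_nonneg_of_le (fun Δ => ?_) hle hsum0
    split_ifs
    · exact mul_nonneg (Nat.cast_nonneg _) (hnn Δ)
    · exact le_rfl
  have htr : ∀ x : V d, (fun Δ : Finset (V d) => if x ∈ Δ then (Δ.card : ℝ) * N Δ else 0) =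
      (fun Δ : Finset (V d) => if (0 : V d) ∈ Δ then (Δ.card : ℝ) * N Δ else 0) ∘
        (Equiv.subRight x).finsetCongr := by
    intro x
    funext Δ
    have h1 : (Equiv.subRight x).finsetCongr Δ = Δ.image (fun z => z - x) := by
      ext z
      simp [sub_eq_iff_eq_add]
    have h2 : N (Δ.image (fun z => z - x)) = N Δ := by
      simp only [hN, edg_trans, supNorm_trans ht]
    have h3 : (0 : V d) ∈ Δ.image (fun z => z - x) ↔ x ∈ Δ := by
      simp [sub_eq_zero]
    simp only [Function.comp_apply, h1, h2, h3,
      Finset.card_image_of_injective _ (sub_left_injective (b := x))]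
  refine ⟨?_, hbd, fun x => ?_, fun x => ?_⟩
  · intro Δ ω ω' h
    unfold Iadd
    rw [ising_local β Δ ω ω' h, hl Δ ω ω' h]
  · rw [htr x]
    exact (Equiv.summable_iff _).2 hsm
  · have : ∑' Δ : Finset (V d), (if x ∈ Δ then (Δ.card : ℝ) * N Δ else 0) =
        ∑' Δ : Finset (V d), (if (0 : V d) ∈ Δ then (Δ.card : ℝ) * N Δ else 0) := by
      rw [htr x]
      exact Equiv.tsum_eq ((Equiv.subRight x).finsetCongr)
        (fun Δ : Finset (V d) => if (0 : V d) ∈ Δ then (Δ.card : ℝ) * N Δ else 0)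
    rw [this]
    refine (hsm.tsum_le_tsum hle hsum0).trans (le_of_eq ?_)
    rw [(edg0_sm.mul_left β).tsum_add hs, tsum_mul_left]
    rfl

lemma edg0_nn : 0 ≤ ∑' Δ, edg0 (d := d) Δ := by
  refine tsum_nonneg (fun Δ => ?_)
  unfold edg0 edg
  split_ifs <;> simp

/-- There exist `β_h > 0` and `δ > 0` such that for every `β` with
`0 < β ≤ β_h` and every translation invariant interaction `Ψ` with `|||Ψ||| < δ`,
the interaction `Φ = Φ^β + Ψ` has a unique Gibbs state. -/
theorem uniqueness_high_temperature (d : ℕ) (hd : 2 ≤ d) :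
    ∃ βh > (0:ℝ), ∃ δ > (0:ℝ), ∀ β : ℝ, 0 < β → β ≤ βh →
      ∀ Ψ : Interaction d, IsLocal Ψ → TransInv Ψ → DSummable Ψ → dnorm Ψ < δ →
        ∃! σ : Measure (Config d), IsGibbs (Iadd (ising β) Ψ) σ := by
  have hK := edg0_nn (d := d)
  set K := ∑' Δ, edg0 (d := d) Δ with hKdef
  refine ⟨1 / (64 * (K + 1)), by positivity, 1 / 64, by norm_num, ?_⟩
  intro β hβ hβh Ψ hl ht hs hn
  have hdom := dom_main β hβ Ψ hl ht hs
  have hS : β * K + dnorm Ψ ≤ 1 / 32 := by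
    have h1 : β * (64 * (K + 1)) ≤ 1 := (le_div_iff₀ (by positivity)).1 hβh
    nlinarith
  obtain ⟨σ, hσ⟩ := hdom.exists_gibbs
  exact ⟨σ, hσ, fun σ' hσ' => hdom.unique hS hσ' hσ⟩

end
end Ising
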